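/- Let A_1, …, A_m ∈ M_n be Hermitian matrices and let k be an integer with 1 ≤ k ≤ n/2. If conv W_k(A_1, …, A_m) is polyhedral, then W_r(A_1, …, A_m) is polyhedral for every integer r with 1 ≤ r ≤ k. -/

import Mathlib

open Matrix

/-- The joint `C`-numerical range of a tuple of Hermitian matrices, regarded as a
subset of `ℝ^m`. -/
noncomputable def jointCNumRangeR {N m : ℕ} (C : Matrix (Fin N) (Fin N) ℂ)
    (A : Fin m → Matrix (Fin N) (Fin N) ℂ) : Set (Fin m → ℝ) :=
  { p | ∃ U ∈ Matrix.unitaryGroup (Fin N) ℂ,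
      ∀ j, (p j : ℂ) = (C * (star U * A j * U)).trace }

/-- The joint `k`-numerical range: the `C`-numerical range with
`C = diag(1, …, 1, 0, …, 0)` having exactly `k` ones. -/
noncomputable def jointKNumRangeR {N m : ℕ} (k : ℕ)
    (A : Fin m → Matrix (Fin N) (Fin N) ℂ) : Set (Fin m → ℝ) :=
  jointCNumRangeR (Matrix.diagonal fun i : Fin N => if (i : ℕ) < k then (1 : ℂ) else 0) A

/-- A subset of a real vector space is polyhedral if it is the convex hull of a finite set. -/
def IsPolyhedral {E : Type*} [AddCommGroup E] [Module ℝ E] (S : Set E) : Prop :=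
  ∃ F : Set E, F.Finite ∧ S = convexHull ℝ F

namespace JointKNumRange

open scoped ComplexOrder

section Positivity

variable {n : ℕ}

theorem posSemidef_mul_eq_zero {N X : Matrix (Fin n) (Fin n) ℂ} (hN : N.PosSemidef)
    (h : Xᴴ * N * X = 0) : N * X = 0 := by
  ext i j
  have h1 : star (X.col j) ⬝ᵥ N *ᵥ X.col j = 0 := by
    have h2 := congrFun (congrFun h j) j
    rw [Matrix.mul_assoc, Matrix.mul_apply] at h2
    simpa [dotProduct, mulVec, Matrix.mul_apply] using h2
  exact congrFun ((hN.dotProduct_mulVec_zero_iff _).1 h1) i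

theorem posSemidef_sandwich {N X : Matrix (Fin n) (Fin n) ℂ} (hN : N.PosSemidef)
    (hX : X.IsHermitian) : (X * N * X).PosSemidef := by
  simpa [hX.eq] using hN.conjTranspose_mul_mul_same X

theorem posSemidef_mul_eq_zero_of_trace {N X : Matrix (Fin n) (Fin n) ℂ} (hN : N.PosSemidef)
    (hX : X.IsHermitian) (h : (X * N * X).trace.re ≤ 0) : N * X = 0 := by
  have h1 := posSemidef_sandwich hN hX
  have h2 := h1.trace_nonneg
  apply posSemidef_mul_eq_zero hN
  rw [hX.eq, ← h1.trace_eq_zero_iff]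
  rw [Complex.le_def] at h2
  apply Complex.ext
  · exact le_antisymm h h2.1
  · exact h2.2.symm

/-- `P` is an orthogonal projection commuting with `C` such that `C ≥ l` on the range of `P` and
`C ≤ l` on its kernel. -/
structure IsTop (C P : Matrix (Fin n) (Fin n) ℂ) (l : ℝ) : Prop where
  herm : P.IsHermitian
  idem : P * P = P
  comm : C * P = P * C
  top : ((C - (l : ℂ) • 1) * P).PosSemidef
  bot : (((l : ℂ) • 1 - C) * (1 - P)).PosSemidef

theorem trace_gap {M P P' : Matrix (Fin n) (Fin n) ℂ} (h' : P' * P' = P')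
    (hc : M * P = P * M) :
    (P * M).trace - (P' * M).trace =
      ((1 - P') * (M * P) * (1 - P')).trace + (P' * (-M * (1 - P)) * P').trace := by
  have e1 : ((1 - P') * (M * P) * (1 - P')).trace = (M * P).trace - (M * P * P').trace := by
    rw [Matrix.trace_mul_comm, ← Matrix.mul_assoc,
      show (1 - P') * (1 - P') = 1 - P' by
        rw [Matrix.mul_sub, Matrix.sub_mul _ _ P', h']; simp, Matrix.sub_mul, one_mul,
      Matrix.trace_sub, Matrix.trace_mul_comm P']
  have e2 : (P' * (-M * (1 - P)) * P').trace = (M * P * P').trace - (M * P').trace := by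
    rw [Matrix.trace_mul_comm, ← Matrix.mul_assoc, h', Matrix.trace_mul_comm, ← Matrix.trace_sub]
    congr 1
    noncomm_ring
  rw [e1, e2, hc, Matrix.trace_mul_comm P' M]
  ring

theorem trace_shift (C P : Matrix (Fin n) (Fin n) ℂ) (l : ℂ) :
    (P * (C - l • 1)).trace = (P * C).trace - l * P.trace := by
  rw [Matrix.mul_sub, Matrix.trace_sub]; simp

theorem IsTop.trace_le {C P P' : Matrix (Fin n) (Fin n) ℂ} {l : ℝ} (h : IsTop C P l)
    (hP' : P'.IsHermitian) (h' : P' * P' = P') (ht : P'.trace = P.trace) :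
    (P' * C).trace.re ≤ (P * C).trace.re := by
  have hc : (C - (l : ℂ) • 1) * P = P * (C - (l : ℂ) • 1) := by
    simp [Matrix.sub_mul, Matrix.mul_sub, h.comm]
  have g := trace_gap h' hc
  rw [trace_shift, trace_shift, ht] at g
  have a1 := (posSemidef_sandwich h.top (X := 1 - P') (by simp [IsHermitian, hP'.eq])).trace_nonneg
  have a2 := (posSemidef_sandwich h.bot hP').trace_nonneg
  rw [neg_sub] at g
  have := congrArg Complex.re g
  simp only [Complex.sub_re, Complex.add_re] at this
  have b1 := (Complex.le_def.1 a1).1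
  have b2 := (Complex.le_def.1 a2).1
  simp only [Complex.zero_re] at b1 b2
  linarith

theorem IsTop.mul_eq {C P P' : Matrix (Fin n) (Fin n) ℂ} {l : ℝ} (h : IsTop C P l)
    (hP' : P'.IsHermitian) (h' : P' * P' = P') (ht : P'.trace = P.trace)
    (hle : (P * C).trace.re ≤ (P' * C).trace.re) :
    (C - (l : ℂ) • 1) * P = (C - (l : ℂ) • 1) * P' := by
  have hc : (C - (l : ℂ) • 1) * P = P * (C - (l : ℂ) • 1) := by
    simp [Matrix.sub_mul, Matrix.mul_sub, h.comm]
  have g := trace_gap h' hc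
  rw [trace_shift, trace_shift, ht] at g
  have h1 : (1 - P').IsHermitian := by simp [IsHermitian, hP'.eq]
  have a1 := (posSemidef_sandwich h.top h1).trace_nonneg
  have a2 := (posSemidef_sandwich h.bot hP').trace_nonneg
  rw [neg_sub] at g
  have := congrArg Complex.re g
  simp only [Complex.sub_re, Complex.add_re] at this
  have b1 := (Complex.le_def.1 a1).1
  have b2 := (Complex.le_def.1 a2).1
  simp only [Complex.zero_re] at b1 b2
  have z1 := posSemidef_mul_eq_zero_of_trace h.top h1 (by linarith)
  have z2 := posSemidef_mul_eq_zero_of_trace h.bot hP' (by linarith)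
  set M := C - (l : ℂ) • (1 : Matrix (Fin n) (Fin n) ℂ) with hM
  rw [← neg_sub, ← hM] at z2
  have e1 : M * P = M * P * P' := by
    rw [Matrix.mul_sub, Matrix.mul_one, sub_eq_zero] at z1; exact z1
  have e2 : M * P' = M * P * P' := by
    have : -M * (1 - P) * P' = M * P * P' - M * P' := by noncomm_ring
    rw [this, sub_eq_zero] at z2; exact z2.symm
  rw [e1, e2]

theorem IsTop.of_mul_eq {C P P' : Matrix (Fin n) (Fin n) ℂ} {l : ℝ} (h : IsTop C P l)
    (hC : C.IsHermitian) (hP' : P'.IsHermitian) (h' : P' * P' = P')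
    (he : (C - (l : ℂ) • 1) * P = (C - (l : ℂ) • 1) * P') : IsTop C P' l := by
  have hM : (C - (l : ℂ) • (1 : Matrix (Fin n) (Fin n) ℂ)).IsHermitian := by
    simp [IsHermitian, hC.eq]
  have hc : (C - (l : ℂ) • 1) * P' = P' * (C - (l : ℂ) • 1) := by
    have := h.top.1
    rw [he] at this
    have := this.eq
    rw [conjTranspose_mul, hM.eq, hP'.eq] at this
    exact this.symm
  refine ⟨hP', h', ?_, ?_, ?_⟩
  · simpa [Matrix.sub_mul, Matrix.mul_sub] using hc
  · rw [← he]; exact h.top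
  · have : ((l : ℂ) • 1 - C) * (1 - P') = ((l : ℂ) • 1 - C) * (1 - P) := by
      rw [← neg_sub C, Matrix.neg_mul, Matrix.neg_mul, Matrix.mul_sub _ 1 P', ← he, ← Matrix.mul_sub]
    rw [this]; exact h.bot

end Positivity

section RankProj

variable {n : ℕ}

/-- The orthogonal projection onto the span of the first `k` standard basis vectors. -/
def coordProj (n k : ℕ) : Matrix (Fin n) (Fin n) ℂ :=
  Matrix.diagonal fun i : Fin n => if (i : ℕ) < k then (1 : ℂ) else 0

/-- The set of orthogonal projections that are unitarily similar to `coordProj n k`. -/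
def rankProj (n k : ℕ) : Set (Matrix (Fin n) (Fin n) ℂ) :=
  {P | ∃ U ∈ Matrix.unitaryGroup (Fin n) ℂ, P = U * coordProj n k * star U}

theorem star_mul_self_cancel {U : Matrix (Fin n) (Fin n) ℂ} (hU : U ∈ unitaryGroup (Fin n) ℂ)
    (X : Matrix (Fin n) (Fin n) ℂ) : star U * (U * X) = X := by
  rw [← Matrix.mul_assoc, mem_unitaryGroup_iff'.1 hU, one_mul]

theorem mul_star_self_cancel {U : Matrix (Fin n) (Fin n) ℂ} (hU : U ∈ unitaryGroup (Fin n) ℂ)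
    (X : Matrix (Fin n) (Fin n) ℂ) : U * (star U * X) = X := by
  rw [← Matrix.mul_assoc, mem_unitaryGroup_iff.1 hU, one_mul]

theorem conj_mul_conj {U : Matrix (Fin n) (Fin n) ℂ} (hU : U ∈ unitaryGroup (Fin n) ℂ)
    (X Y : Matrix (Fin n) (Fin n) ℂ) :
    (U * X * star U) * (U * Y * star U) = U * (X * Y) * star U := by
  simp only [Matrix.mul_assoc, star_mul_self_cancel hU]

theorem trace_conj {U : Matrix (Fin n) (Fin n) ℂ} (hU : U ∈ unitaryGroup (Fin n) ℂ)
    (X : Matrix (Fin n) (Fin n) ℂ) : (U * X * star U).trace = X.trace := by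
  rw [Matrix.trace_mul_comm, star_mul_self_cancel hU]

theorem isHermitian_conj {X : Matrix (Fin n) (Fin n) ℂ} (U : Matrix (Fin n) (Fin n) ℂ)
    (hX : X.IsHermitian) : (U * X * star U).IsHermitian := by
  simp [IsHermitian, star_eq_conjTranspose, Matrix.mul_assoc, hX.eq]

theorem coordProj_isHermitian (k : ℕ) : (coordProj n k).IsHermitian := by
  refine isHermitian_diagonal_of_self_adjoint _ (funext fun i => ?_)
  simp only [Pi.star_apply]
  split_ifs <;> simp

theorem coordProj_idem (k : ℕ) : coordProj n k * coordProj n k = coordProj n k := by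
  rw [coordProj, Matrix.diagonal_mul_diagonal]
  congr 1; funext i; split_ifs <;> simp

theorem coordProj_trace {k : ℕ} (hk : k ≤ n) : (coordProj n k).trace = k := by
  rw [coordProj, Matrix.trace_diagonal, Finset.sum_boole]
  congr 1
  rw [← Fintype.card_subtype, Fintype.card_congr (Fin.castLEquiv hk).symm]
  simp

theorem isHermitian_of_mem_rankProj {k : ℕ} {P : Matrix (Fin n) (Fin n) ℂ}
    (hP : P ∈ rankProj n k) : P.IsHermitian := by
  obtain ⟨U, -, rfl⟩ := hP
  exact isHermitian_conj U (coordProj_isHermitian k)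

theorem idem_of_mem_rankProj {k : ℕ} {P : Matrix (Fin n) (Fin n) ℂ}
    (hP : P ∈ rankProj n k) : P * P = P := by
  obtain ⟨U, hU, rfl⟩ := hP
  rw [conj_mul_conj hU, coordProj_idem]

theorem trace_of_mem_rankProj {k : ℕ} (hk : k ≤ n) {P : Matrix (Fin n) (Fin n) ℂ}
    (hP : P ∈ rankProj n k) : P.trace = k := by
  obtain ⟨U, hU, rfl⟩ := hP
  rw [trace_conj hU, coordProj_trace hk]

theorem conj_mem_rankProj {k : ℕ} {P U : Matrix (Fin n) (Fin n) ℂ}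
    (hU : U ∈ unitaryGroup (Fin n) ℂ) (hP : P ∈ rankProj n k) :
    U * P * star U ∈ rankProj n k := by
  obtain ⟨V, hV, rfl⟩ := hP
  exact ⟨U * V, mul_mem hU hV, by simp only [star_mul, Matrix.mul_assoc]⟩

theorem permMatrix_mem_unitaryGroup (σ : Equiv.Perm (Fin n)) :
    σ.permMatrix ℂ ∈ unitaryGroup (Fin n) ℂ := by
  rw [mem_unitaryGroup_iff, star_eq_conjTranspose, Matrix.conjTranspose_permMatrix,
    ← Matrix.permMatrix_mul]
  simp

theorem permMatrix_conj_diagonal (σ : Equiv.Perm (Fin n)) (d : Fin n → ℂ) :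
    σ.permMatrix ℂ * diagonal d * star (σ.permMatrix ℂ) = diagonal (d ∘ σ) := by
  rw [star_eq_conjTranspose, Matrix.conjTranspose_permMatrix, Equiv.Perm.permMatrix,
    Equiv.Perm.permMatrix, PEquiv.toMatrix_toPEquiv_mul, PEquiv.mul_toMatrix_toPEquiv]
  ext i j
  have : (Equiv.symm σ⁻¹) j = σ j := rfl
  simp [Matrix.diagonal_apply, this]

theorem diagonal_mem_rankProj {k : ℕ} (J : Finset (Fin n)) (hJ : J.card = k) :
    (diagonal fun i : Fin n => if i ∈ J then (1 : ℂ) else 0) ∈ rankProj n k := by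
  have hk : k ≤ n := by simpa [hJ] using J.card_le_univ
  have hc : Fintype.card {i : Fin n // i ∈ J} = Fintype.card {i : Fin n // (i : ℕ) < k} := by
    rw [Fintype.card_congr (Fin.castLEquiv hk).symm]
    simp [hJ]
  let e := Fintype.equivOfCardEq hc
  let σ := e.extendSubtype
  refine ⟨σ.permMatrix ℂ, permMatrix_mem_unitaryGroup σ, ?_⟩
  rw [coordProj, permMatrix_conj_diagonal]
  congr 1
  funext i
  by_cases h : i ∈ J
  · simp [h, σ, e.extendSubtype_mem i h]
  · simp [h, σ, not_lt.1 (e.extendSubtype_not_mem i h)]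

theorem IsTop.conj {C P U : Matrix (Fin n) (Fin n) ℂ} {l : ℝ} (h : IsTop C P l)
    (hU : U ∈ unitaryGroup (Fin n) ℂ) : IsTop (U * C * star U) (U * P * star U) l := by
  have e1 : U * 1 * star U = 1 := by rw [Matrix.mul_one, mem_unitaryGroup_iff.1 hU]
  have e2 : ∀ X Y : Matrix (Fin n) (Fin n) ℂ,
      U * X * star U - U * Y * star U = U * (X - Y) * star U := by
    intro X Y; noncomm_ring
  have e3 : (l : ℂ) • (1 : Matrix (Fin n) (Fin n) ℂ) = U * ((l : ℂ) • 1) * star U := by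
    rw [Matrix.mul_smul, Matrix.smul_mul, e1]
  refine ⟨isHermitian_conj U h.herm, by rw [conj_mul_conj hU, h.idem], ?_, ?_, ?_⟩
  · rw [conj_mul_conj hU, conj_mul_conj hU, h.comm]
  · rw [e3, e2, conj_mul_conj hU]
    exact h.top.mul_mul_conjTranspose_same U
  · have e4 : 1 - U * P * star U = U * (1 - P) * star U := by rw [← e2, e1]
    rw [e4, e3, e2, conj_mul_conj hU]
    exact h.bot.mul_mul_conjTranspose_same U

theorem isTop_diagonal {d : Fin n → ℝ} {J : Finset (Fin n)} {l : ℝ} (h1 : ∀ i ∈ J, l ≤ d i)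
    (h2 : ∀ i ∉ J, d i ≤ l) :
    IsTop (diagonal fun i => (d i : ℂ)) (diagonal fun i => if i ∈ J then (1 : ℂ) else 0) l := by
  have e : (l : ℂ) • (1 : Matrix (Fin n) (Fin n) ℂ) = diagonal fun _ => (l : ℂ) := by
    rw [Matrix.smul_one_eq_diagonal]
  have e1 : (1 : Matrix (Fin n) (Fin n) ℂ) = diagonal fun _ => 1 := by simp
  refine ⟨?_, ?_, ?_, ?_, ?_⟩
  · refine isHermitian_diagonal_of_self_adjoint _ (funext fun i => ?_)
    simp only [Pi.star_apply]
    split_ifs <;> simp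
  · rw [Matrix.diagonal_mul_diagonal]
    congr 1; funext i; split_ifs <;> simp
  · rw [Matrix.diagonal_mul_diagonal, Matrix.diagonal_mul_diagonal]
    congr 1; funext i; ring
  · rw [e, Matrix.diagonal_sub, Matrix.diagonal_mul_diagonal, posSemidef_diagonal_iff]
    intro i
    split_ifs with h
    · rw [mul_one, ← Complex.ofReal_sub]; exact_mod_cast sub_nonneg.2 (h1 i h)
    · simp
  · rw [e, e1, Matrix.diagonal_sub, Matrix.diagonal_sub, Matrix.diagonal_mul_diagonal,
      posSemidef_diagonal_iff]
    intro i
    split_ifs with h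
    · simp
    · rw [sub_zero, mul_one, ← Complex.ofReal_sub]; exact_mod_cast sub_nonneg.2 (h2 i h)

theorem exists_antitone_diagonalization {C : Matrix (Fin n) (Fin n) ℂ} (hC : C.IsHermitian) :
    ∃ U ∈ unitaryGroup (Fin n) ℂ, ∃ d : Fin n → ℝ, Antitone d ∧
      C = U * (diagonal fun i => (d i : ℂ)) * star U := by
  let σ := Tuple.sort (fun i => -hC.eigenvalues i)
  have hσ := Tuple.monotone_sort (fun i => -hC.eigenvalues i)
  let V := star (σ.permMatrix ℂ)
  have hV : V ∈ unitaryGroup (Fin n) ℂ := Unitary.star_mem (permMatrix_mem_unitaryGroup σ)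
  refine ⟨hC.eigenvectorUnitary * V, mul_mem hC.eigenvectorUnitary.2 hV,
    hC.eigenvalues ∘ σ, fun i j hij => by simpa using hσ hij, ?_⟩
  have h1 := permMatrix_conj_diagonal σ (fun i => (hC.eigenvalues i : ℂ))
  have h2 := hC.spectral_theorem
  rw [Unitary.conjStarAlgAut_apply] at h2
  have h3 : (diagonal fun i => (((hC.eigenvalues ∘ σ) i : ℝ) : ℂ)) =
      σ.permMatrix ℂ * (diagonal fun i => (hC.eigenvalues i : ℂ)) * star (σ.permMatrix ℂ) := by
    rw [h1]; rfl
  rw [h3]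
  simp only [V, star_mul, star_star, Matrix.mul_assoc]
  rw [star_mul_self_cancel (permMatrix_mem_unitaryGroup σ),
    star_mul_self_cancel (permMatrix_mem_unitaryGroup σ), ← Matrix.mul_assoc]
  exact h2

/-- The projection `P` of rank `k` maximizes `tr (P C)`. -/
def IsMax (k : ℕ) (C P : Matrix (Fin n) (Fin n) ℂ) : Prop :=
  P ∈ rankProj n k ∧ ∀ P' ∈ rankProj n k, (P' * C).trace.re ≤ (P * C).trace.re

theorem IsTop.isMax {k : ℕ} (hk : k ≤ n) {C P : Matrix (Fin n) (Fin n) ℂ} {l : ℝ}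
    (h : IsTop C P l) (hP : P ∈ rankProj n k) : IsMax k C P :=
  ⟨hP, fun _ hP' => h.trace_le (isHermitian_of_mem_rankProj hP') (idem_of_mem_rankProj hP')
    (by rw [trace_of_mem_rankProj hk hP', trace_of_mem_rankProj hk hP])⟩

theorem IsTop.of_isMax {k : ℕ} (hk : k ≤ n) {C P P' : Matrix (Fin n) (Fin n) ℂ} {l : ℝ}
    (h : IsTop C P l) (hC : C.IsHermitian) (hP : P ∈ rankProj n k) (hP' : IsMax k C P') :
    (C - (l : ℂ) • 1) * P = (C - (l : ℂ) • 1) * P' ∧ IsTop C P' l := by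
  have e := h.mul_eq (isHermitian_of_mem_rankProj hP'.1) (idem_of_mem_rankProj hP'.1)
    (by rw [trace_of_mem_rankProj hk hP'.1, trace_of_mem_rankProj hk hP]) (hP'.2 P hP)
  exact ⟨e, h.of_mul_eq hC (isHermitian_of_mem_rankProj hP'.1) (idem_of_mem_rankProj hP'.1) e⟩

/-- Ky Fan's principle, applied to both `C` and `-C`. -/
theorem exists_isTop_pair {k : ℕ} (hk1 : 1 ≤ k) (hk2 : 2 * k ≤ n) {C : Matrix (Fin n) (Fin n) ℂ}
    (hC : C.IsHermitian) :
    ∃ l l' : ℝ, l' ≤ l ∧ (∃ P ∈ rankProj n k, IsTop C P l) ∧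
      ∃ P ∈ rankProj n k, IsTop (-C) P (-l') := by
  obtain ⟨U, hU, d, hd, rfl⟩ := exists_antitone_diagonalization hC
  refine ⟨d ⟨k - 1, by omega⟩, d ⟨n - k, by omega⟩, hd (Fin.mk_le_mk.2 (by omega)), ?_, ?_⟩
  · refine ⟨_, conj_mem_rankProj hU (diagonal_mem_rankProj
      (Finset.univ.filter fun i : Fin n => (i : ℕ) < k) ?_), (isTop_diagonal ?_ ?_).conj hU⟩
    · rw [← Fintype.card_subtype, Fintype.card_congr (Fin.castLEquiv (show k ≤ n by omega)).symm]
      simp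
    · intro i hi
      simp only [Finset.mem_filter, Finset.mem_univ, true_and] at hi
      exact hd (Fin.mk_le_mk.2 (by omega))
    · intro i hi
      simp only [Finset.mem_filter, Finset.mem_univ, true_and] at hi
      exact hd (Fin.mk_le_mk.2 (by omega))
  · have e : -(U * (diagonal fun i => (d i : ℂ)) * star U) =
        U * (diagonal fun i => ((-d i : ℝ) : ℂ)) * star U := by
      rw [← Matrix.neg_mul, ← Matrix.mul_neg, Matrix.diagonal_neg]
      simp
    rw [e]
    refine ⟨_, conj_mem_rankProj hU (diagonal_mem_rankProj
      (Finset.univ.filter fun i : Fin n => n - k ≤ (i : ℕ)) ?_), (isTop_diagonal ?_ ?_).conj hU⟩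
    · have h1 := Finset.card_filter_add_card_filter_not (s := (Finset.univ : Finset (Fin n)))
        (fun i : Fin n => n - k ≤ (i : ℕ))
      have h2 : (Finset.univ.filter fun i : Fin n => ¬ n - k ≤ (i : ℕ)).card = n - k := by
        simp only [not_le]
        rw [← Fintype.card_subtype,
          Fintype.card_congr (Fin.castLEquiv (show n - k ≤ n by omega)).symm]
        simp
      rw [h2] at h1
      simp only [Finset.card_univ, Fintype.card_fin] at h1
      omega
    · intro i hi
      simp only [Finset.mem_filter, Finset.mem_univ, true_and] at hi
      exact neg_le_neg (hd (Fin.mk_le_mk.2 (by omega)))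
    · intro i hi
      simp only [Finset.mem_filter, Finset.mem_univ, true_and] at hi
      exact neg_le_neg (hd (Fin.mk_le_mk.2 (by omega)))

end RankProj

section Pencil

variable {n m : ℕ}

/-- The real linear combination `∑ j, u j • A j` as a linear function of `u`. -/
noncomputable def pencil (A : Fin m → Matrix (Fin n) (Fin n) ℂ) :
    (Fin m → ℝ) →ₗ[ℝ] Matrix (Fin n) (Fin n) ℂ :=
  ∑ j, (LinearMap.proj j : (Fin m → ℝ) →ₗ[ℝ] ℝ).smulRight (A j)

theorem pencil_apply (A : Fin m → Matrix (Fin n) (Fin n) ℂ) (u : Fin m → ℝ) :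
    pencil A u = ∑ j, u j • A j := by
  simp [pencil]

theorem pencil_single (A : Fin m → Matrix (Fin n) (Fin n) ℂ) (j : Fin m) :
    pencil A (Pi.single j 1) = A j := by
  rw [pencil_apply, Finset.sum_eq_single j] <;> simp +contextual

theorem pencil_isHermitian {A : Fin m → Matrix (Fin n) (Fin n) ℂ} (hA : ∀ j, (A j).IsHermitian)
    (u : Fin m → ℝ) : (pencil A u).IsHermitian := by
  rw [pencil_apply, IsHermitian, conjTranspose_sum]
  exact Finset.sum_congr rfl fun j _ => by simp [(hA j).eq]

/-- The vector of real parts of the traces `tr (P A j)`. -/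
noncomputable def traceVec (A : Fin m → Matrix (Fin n) (Fin n) ℂ)
    (P : Matrix (Fin n) (Fin n) ℂ) : Fin m → ℝ :=
  fun j => (P * A j).trace.re

theorem trace_mul_pencil (A : Fin m → Matrix (Fin n) (Fin n) ℂ) (P : Matrix (Fin n) (Fin n) ℂ)
    (u : Fin m → ℝ) : (P * pencil A u).trace.re = traceVec A P ⬝ᵥ u := by
  rw [pencil_apply, Matrix.mul_sum, Matrix.trace_sum, Complex.re_sum]
  simp [traceVec, dotProduct, mul_comm]

theorem trace_mul_ofReal_re {P C : Matrix (Fin n) (Fin n) ℂ} (hP : P.IsHermitian)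
    (hC : C.IsHermitian) : ((P * C).trace.re : ℂ) = (P * C).trace := by
  rw [← Complex.conj_eq_iff_re]
  have := Matrix.trace_conjTranspose (P * C)
  rw [conjTranspose_mul, hP.eq, hC.eq, Matrix.trace_mul_comm] at this
  exact this.symm

theorem jointKNumRangeR_eq_image {A : Fin m → Matrix (Fin n) (Fin n) ℂ}
    (hA : ∀ j, (A j).IsHermitian) (k : ℕ) :
    jointKNumRangeR k A = traceVec A '' rankProj n k := by
  have e : ∀ (U : Matrix (Fin n) (Fin n) ℂ) (j : Fin m),
      (coordProj n k * (star U * A j * U)).trace = (U * coordProj n k * star U * A j).trace := by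
    intro U j
    rw [Matrix.mul_assoc U, Matrix.mul_assoc U, Matrix.trace_mul_comm U]
    simp only [Matrix.mul_assoc]
  ext p
  constructor
  · rintro ⟨U, hU, h⟩
    refine ⟨_, ⟨U, hU, rfl⟩, funext fun j => ?_⟩
    rw [traceVec, ← e, ← Complex.ofReal_re (p j), h j]
    rfl
  · rintro ⟨_, ⟨U, hU, rfl⟩, rfl⟩
    refine ⟨U, hU, fun j => ?_⟩
    rw [traceVec, trace_mul_ofReal_re (isHermitian_conj U (coordProj_isHermitian k)) (hA j), ← e]
    rfl

theorem isClosed_isMax (A : Fin m → Matrix (Fin n) (Fin n) ℂ) (k : ℕ)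
    (P : Matrix (Fin n) (Fin n) ℂ) : IsClosed {u | IsMax k (pencil A u) P} := by
  simp only [IsMax, trace_mul_pencil, Set.ofPred_and, Set.ofPred_forall]
  refine isClosed_const.inter (isClosed_iInter fun P' => isClosed_iInter fun _ => ?_)
  exact isClosed_le (by fun_prop) (by fun_prop)

theorem rankProj_nonempty (k : ℕ) : (rankProj n k).Nonempty :=
  ⟨_, 1, one_mem _, rfl⟩

theorem eq_zero_of_eventually_nonneg {q u₀ : Fin m → ℝ} (h0 : q ⬝ᵥ u₀ = 0)
    (h : ∀ᶠ u in nhds u₀, 0 ≤ q ⬝ᵥ u) : q = 0 := by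
  have hc : Filter.Tendsto (fun t : ℝ => u₀ - t • q) (nhdsWithin 0 (Set.Ioi 0)) (nhds u₀) := by
    have : Continuous fun t : ℝ => u₀ - t • q := by fun_prop
    have h1 := this.tendsto 0
    simp only [zero_smul, sub_zero] at h1
    exact h1.mono_left nhdsWithin_le_nhds
  obtain ⟨t, ht, ht0⟩ := ((hc.eventually h).and self_mem_nhdsWithin).exists
  rw [dotProduct_sub, h0, dotProduct_smul, smul_eq_mul, zero_sub] at ht
  have h2 : 0 ≤ q ⬝ᵥ q := by simpa using dotProduct_star_self_nonneg q
  have h3 : q ⬝ᵥ q = 0 := by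
    have : 0 < t := ht0
    nlinarith
  exact dotProduct_self_eq_zero.1 h3

theorem exists_exposed_projections {A : Fin m → Matrix (Fin n) (Fin n) ℂ}
    (hA : ∀ j, (A j).IsHermitian) {k : ℕ} (hk1 : 1 ≤ k) (hk2 : 2 * k ≤ n)
    (hpoly : IsPolyhedral (convexHull ℝ (jointKNumRangeR k A))) :
    ∃ S : Finset (Matrix (Fin n) (Fin n) ℂ),
      (∀ P ∈ S, (interior {u | IsMax k (pencil A u) P}).Nonempty) ∧
      ∀ u, ∃ P ∈ S, IsMax k (pencil A u) P := by
  classical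
  obtain ⟨F, hF, hFe⟩ := hpoly
  rw [jointKNumRangeR_eq_image hA] at hFe
  let N : (Fin m → ℝ) → Set (Fin m → ℝ) := fun v => {u | ∀ v' ∈ F, v' ⬝ᵥ u ≤ v ⬝ᵥ u}
  have hNc : ∀ v ∈ F, IsClosed (N v) := by
    intro v _
    simp only [N, Set.ofPred_forall]
    exact isClosed_iInter fun v' => isClosed_iInter fun _ =>
      isClosed_le (by fun_prop) (by fun_prop)
  have hFne : F.Nonempty := by
    rw [← convexHull_nonempty_iff (𝕜 := ℝ), ← hFe, convexHull_nonempty_iff]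
    exact (rankProj_nonempty k).image _
  have hNu : ⋃ v ∈ F, N v = Set.univ := by
    refine Set.eq_univ_of_forall fun u => ?_
    obtain ⟨v, hv, hmax⟩ := Set.exists_max_image F (fun v => v ⬝ᵥ u) hF hFne
    exact Set.mem_biUnion hv hmax
  have hD := dense_biUnion_interior_of_closed hNc hF.countable hNu
  have hull_le : ∀ {G : Set (Fin m → ℝ)} {u : Fin m → ℝ} {c : ℝ} , (∀ p ∈ G, p ⬝ᵥ u ≤ c) →
      ∀ p ∈ convexHull ℝ G, p ⬝ᵥ u ≤ c := by
    intro G u c h p hp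
    refine convexHull_min (t := {p | p ⬝ᵥ u ≤ c}) h ?_ hp
    exact convex_halfSpace_le ⟨fun x y => add_dotProduct x y u, fun c x => smul_dotProduct c x u⟩ c
  have key : ∀ v ∈ F, (interior (N v)).Nonempty →
      ∃ P, N v ⊆ {u | IsMax k (pencil A u) P} := by
    rintro v hv ⟨u₀, hu₀⟩
    obtain ⟨l, -, -, ⟨P, hP, hT⟩, -⟩ := exists_isTop_pair hk1 hk2 (pencil_isHermitian hA u₀)
    have hm := hT.isMax (by omega) hP
    have hp : traceVec A P ∈ convexHull ℝ F :=
      hFe ▸ subset_convexHull ℝ _ (Set.mem_image_of_mem _ hP)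
    have hv' : v ∈ convexHull ℝ (traceVec A '' rankProj n k) := hFe ▸ subset_convexHull ℝ _ hv
    have a1 : ∀ u ∈ N v, traceVec A P ⬝ᵥ u ≤ v ⬝ᵥ u := fun u hu => hull_le hu _ hp
    have a2 : v ⬝ᵥ u₀ ≤ traceVec A P ⬝ᵥ u₀ := by
      refine hull_le ?_ _ hv'
      rintro _ ⟨P', hP', rfl⟩
      simpa only [trace_mul_pencil] using hm.2 P' hP'
    have e : v - traceVec A P = 0 := by
      refine eq_zero_of_eventually_nonneg (u₀ := u₀) ?_ ?_
      · rw [sub_dotProduct, sub_eq_zero]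
        exact le_antisymm a2 (a1 _ (interior_subset hu₀))
      · filter_upwards [mem_interior_iff_mem_nhds.1 hu₀] with u hu
        rw [sub_dotProduct]
        exact sub_nonneg.2 (a1 u hu)
    rw [sub_eq_zero] at e
    refine ⟨P, fun u hu => ⟨hP, fun P' hP' => ?_⟩⟩
    rw [trace_mul_pencil, trace_mul_pencil, ← e]
    exact hull_le hu _ (hFe ▸ subset_convexHull ℝ _ (Set.mem_image_of_mem _ hP'))
  let V : Set (Fin m → ℝ) := {v ∈ F | (interior (N v)).Nonempty}
  have hV : V.Finite := hF.subset (Set.sep_subset _ _)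
  choose! f hf using fun v (hv : v ∈ V) => key v hv.1 hv.2
  refine ⟨hV.toFinset.image f, ?_, ?_⟩
  · intro P hP
    obtain ⟨v, hv, rfl⟩ := Finset.mem_image.1 hP
    rw [Set.Finite.mem_toFinset] at hv
    exact hv.2.mono (interior_mono (hf v hv))
  · intro u
    have hcl : IsClosed (⋃ v ∈ V, N v) := hV.isClosed_biUnion fun v hv => hNc v hv.1
    have hsub : ⋃ v ∈ F, interior (N v) ⊆ ⋃ v ∈ V, N v := by
      intro u hu
      obtain ⟨v, hv, hu⟩ := Set.mem_iUnion₂.1 hu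
      exact Set.mem_biUnion (show v ∈ V from ⟨hv, u, hu⟩) (interior_subset hu)
    have hmem : u ∈ ⋃ v ∈ V, N v := closure_minimal hsub hcl (hD u)
    obtain ⟨v, hv, hu⟩ := Set.mem_iUnion₂.1 hmem
    exact ⟨f v, Finset.mem_image_of_mem f (hV.mem_toFinset.2 hv), hf v hv hu⟩

end Pencil

section Commutator

variable {n m : ℕ}

theorem linearMap_eq_zero_of_interior {E : Type*} [AddCommGroup E] [Module ℝ E]
    (L : (Fin m → ℝ) →ₗ[ℝ] E) {s : Set (Fin m → ℝ)} (hs : (interior s).Nonempty)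
    (h : ∀ u ∈ s, L u = 0) (u : Fin m → ℝ) : L u = 0 := by
  have : LinearMap.ker L = ⊤ :=
    Submodule.eq_top_of_nonempty_interior' _
      (hs.mono (interior_mono fun u hu => LinearMap.mem_ker.2 (h u hu)))
  exact LinearMap.mem_ker.1 (this ▸ Submodule.mem_top)

theorem IsMax.isTop {k : ℕ} (hk1 : 1 ≤ k) (hk2 : 2 * k ≤ n) {C P : Matrix (Fin n) (Fin n) ℂ}
    (hC : C.IsHermitian) (hP : IsMax k C P) : ∃ l, IsTop C P l := by
  obtain ⟨l, -, -, ⟨Q, hQ, hT⟩, -⟩ := exists_isTop_pair hk1 hk2 hC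
  exact ⟨l, (hT.of_isMax (by omega) hC hQ hP).2⟩

theorem commutator_mul_eq_of_isMax {k : ℕ} (hk1 : 1 ≤ k) (hk2 : 2 * k ≤ n)
    {C B P P' : Matrix (Fin n) (Fin n) ℂ} (hC : C.IsHermitian) (hP : IsMax k C P)
    (hP' : IsMax k C P') (hB : B * P = P * B) (hB' : B * P' = P' * B) :
    (C * B - B * C) * P = (C * B - B * C) * P' := by
  obtain ⟨l, hl⟩ := hP.isTop hk1 hk2 hC
  have e := (hl.of_isMax (by omega) hC hP.1 hP').1
  set M := C - (l : ℂ) • (1 : Matrix (Fin n) (Fin n) ℂ) with hM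
  have hK : C * B - B * C = M * B - B * M := by
    simp [hM, Matrix.sub_mul, Matrix.mul_sub]
  have hQ : ∀ Q, B * Q = Q * B → (M * B - B * M) * Q = M * Q * B - B * (M * Q) := by
    intro Q h
    rw [Matrix.sub_mul, Matrix.mul_assoc, h, Matrix.mul_assoc, Matrix.mul_assoc]
  rw [hK, hQ P hB, hQ P' hB', e]

theorem commute_of_exposed {A : Fin m → Matrix (Fin n) (Fin n) ℂ}
    (hA : ∀ j, (A j).IsHermitian) {k : ℕ} (hk1 : 1 ≤ k) (hk2 : 2 * k ≤ n)
    {P : Matrix (Fin n) (Fin n) ℂ} (hP : (interior {u | IsMax k (pencil A u) P}).Nonempty)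
    (u : Fin m → ℝ) : pencil A u * P = P * pencil A u := by
  have := linearMap_eq_zero_of_interior
    ((LinearMap.mulRight ℝ P - LinearMap.mulLeft ℝ P) ∘ₗ pencil A) hP (fun u hu => by
      obtain ⟨l, hl⟩ := IsMax.isTop hk1 hk2 (pencil_isHermitian hA u) hu
      simp [hl.comm]) u
  simpa [sub_eq_zero] using this

theorem exists_scalar_of_isMax_neg {k : ℕ} (hk1 : 1 ≤ k) (hk2 : 2 * k ≤ n)
    {C P P' : Matrix (Fin n) (Fin n) ℂ} (hC : C.IsHermitian) (hP : IsMax k C P)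
    (hP' : IsMax k (-C) P') :
    ∃ l : ℂ, ∀ Z : Matrix (Fin n) (Fin n) ℂ, P * Z = Z → P' * Z = Z → C * Z = l • Z := by
  obtain ⟨l, l', hle, ⟨Q, hQ, hT⟩, ⟨Q', hQ', hT'⟩⟩ := exists_isTop_pair hk1 hk2 hC
  have h1 := (hT.of_isMax (by omega) hC hQ hP).2
  have h2 := (hT'.of_isMax (by omega) hC.neg hQ' hP').2
  refine ⟨l, fun Z hZ hZ' => ?_⟩
  have a1 := h1.top.conjTranspose_mul_mul_same Z
  have a2 := h2.top.conjTranspose_mul_mul_same Z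
  have a3 : (((l - l' : ℝ) : ℂ) • (Zᴴ * Z)).PosSemidef :=
    (posSemidef_conjTranspose_mul_self Z).smul (by exact_mod_cast sub_nonneg.2 hle)
  have e1 : Zᴴ * ((C - (l : ℂ) • 1) * P) * Z = Zᴴ * C * Z - (l : ℂ) • (Zᴴ * Z) := by
    simp only [Matrix.mul_assoc, hZ]
    simp [Matrix.sub_mul, Matrix.mul_sub]
  have e2 : Zᴴ * ((-C - ((-l' : ℝ) : ℂ) • 1) * P') * Z =
      -(Zᴴ * C * Z) + (l' : ℂ) • (Zᴴ * Z) := by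
    simp only [Matrix.mul_assoc, hZ']
    simp [Matrix.mul_add, Matrix.add_mul]
  have hz : Zᴴ * ((C - (l : ℂ) • 1) * P) * Z = 0 := by
    rw [← a1.trace_eq_zero_iff]
    have t1 := a1.trace_nonneg
    have t2 := (a2.add a3).trace_nonneg
    have e3 : Zᴴ * ((-C - ((-l' : ℝ) : ℂ) • 1) * P') * Z + ((l - l' : ℝ) : ℂ) • (Zᴴ * Z) =
        -(Zᴴ * ((C - (l : ℂ) • 1) * P) * Z) := by
      rw [e1, e2, Complex.ofReal_sub, sub_smul]; abel
    rw [e3, Matrix.trace_neg] at t2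
    exact le_antisymm (neg_nonneg.1 t2) t1
  have := posSemidef_mul_eq_zero h1.top hz
  rw [Matrix.mul_assoc, hZ, Matrix.sub_mul, sub_eq_zero] at this
  simpa using this

theorem commutator_mul_eq_zero {A : Fin m → Matrix (Fin n) (Fin n) ℂ}
    (hA : ∀ j, (A j).IsHermitian) {k : ℕ} (hk1 : 1 ≤ k) (hk2 : 2 * k ≤ n)
    {S : Finset (Matrix (Fin n) (Fin n) ℂ)}
    (hS : ∀ P ∈ S, (interior {u | IsMax k (pencil A u) P}).Nonempty)
    (hcov : ∀ u, ∃ P ∈ S, IsMax k (pencil A u) P) {P : Matrix (Fin n) (Fin n) ℂ} (hP : P ∈ S)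
    (u w : Fin m → ℝ) :
    (pencil A u * pencil A w - pencil A w * pencil A u) * P = 0 := by
  have hcomm : ∀ P ∈ S, ∀ u, pencil A u * P = P * pencil A u := fun P hP =>
    commute_of_exposed hA hk1 hk2 (hS P hP)
  have := linearMap_eq_zero_of_interior
    (LinearMap.mulRight ℝ P ∘ₗ (LinearMap.mulRight ℝ (pencil A w) -
      LinearMap.mulLeft ℝ (pencil A w)) ∘ₗ pencil A) (hS P hP) (fun u hu => ?_) u
  · simpa using this
  change (pencil A u * pencil A w - pencil A w * pencil A u) * P = 0
  set K := pencil A u * pencil A w - pencil A w * pencil A u with hK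
  choose f hfS hf using fun θ : ℝ => hcov (Real.cos θ • u + Real.sin θ • w)
  have hrot : ∀ θ : ℝ, ∀ P₁ ∈ S, ∀ P₂ ∈ S,
      IsMax k (pencil A (Real.cos θ • u + Real.sin θ • w)) P₁ →
      IsMax k (pencil A (Real.cos θ • u + Real.sin θ • w)) P₂ → K * P₁ = K * P₂ := by
    intro θ P₁ h₁ P₂ h₂ m₁ m₂
    have := commutator_mul_eq_of_isMax hk1 hk2 (pencil_isHermitian hA _) m₁ m₂
      (hcomm P₁ h₁ (-Real.sin θ • u + Real.cos θ • w))
      (hcomm P₂ h₂ (-Real.sin θ • u + Real.cos θ • w))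
    have hK' : K = pencil A (Real.cos θ • u + Real.sin θ • w) *
        pencil A (-Real.sin θ • u + Real.cos θ • w) -
        pencil A (-Real.sin θ • u + Real.cos θ • w) *
        pencil A (Real.cos θ • u + Real.sin θ • w) := by
      have h1 : K = (Real.cos θ ^ 2 + Real.sin θ ^ 2) • K := by
        rw [Real.cos_sq_add_sin_sq, one_smul]
      rw [h1, hK]
      simp only [map_add, map_smul, Matrix.add_mul, Matrix.mul_add, Matrix.smul_mul,
        Matrix.mul_smul]
      module
    rwa [← hK'] at this
  have hloc : IsLocallyConstant fun θ => K * f θ := by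
    rw [IsLocallyConstant.iff_eventually_eq]
    intro θ₀
    have h1 : ∀ᶠ θ in nhds θ₀, ∀ Q ∈ S,
        IsMax k (pencil A (Real.cos θ • u + Real.sin θ • w)) Q →
        IsMax k (pencil A (Real.cos θ₀ • u + Real.sin θ₀ • w)) Q := by
      rw [Filter.eventually_all_finset]
      intro Q _
      by_cases hQ : IsMax k (pencil A (Real.cos θ₀ • u + Real.sin θ₀ • w)) Q
      · exact Filter.Eventually.of_forall fun _ _ => hQ
      · have hc : Continuous fun θ : ℝ => Real.cos θ • u + Real.sin θ • w := by fun_prop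
        have ho := ((isClosed_isMax A k Q).preimage hc).isOpen_compl
        filter_upwards [ho.mem_nhds hQ] with θ hθ h
        exact absurd h hθ
    filter_upwards [h1] with θ hθ
    exact hrot θ₀ _ (hfS θ) _ (hfS θ₀) (hθ _ (hfS θ) (hf θ)) (hf θ₀)
  have h0 : K * P = K * f 0 := by
    refine hrot 0 _ hP _ (hfS 0) ?_ (hf 0)
    simpa using hu
  have h2 : K * P = K * f Real.pi := h0.trans (hloc.apply_eq_of_preconnectedSpace 0 Real.pi)
  have hfπ : IsMax k (-pencil A u) (f Real.pi) := by simpa using hf Real.pi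
  obtain ⟨l, hl⟩ := exists_scalar_of_isMax_neg hk1 hk2 (pencil_isHermitian hA u) hu hfπ
  have hKc : ∀ Q ∈ S, K * Q = Q * K := by
    intro Q hQ
    have e1 : Commute (pencil A u) Q := hcomm Q hQ u
    have e2 : Commute (pencil A w) Q := hcomm Q hQ w
    exact ((e1.mul_left e2).sub_left (e2.mul_left e1)).eq
  have hfix : ∀ Q ∈ S, K * P = K * Q → Q * (K * P) = K * P ∧
      Q * (pencil A w * (K * P)) = pencil A w * (K * P) := by
    intro Q hQ he
    obtain ⟨v, hv⟩ := hS Q hQ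
    have hv' : v ∈ {u | IsMax k (pencil A u) Q} := interior_subset hv
    have hQi := idem_of_mem_rankProj hv'.1
    have a : Q * (K * P) = K * P := by
      rw [he, hKc Q hQ, ← Matrix.mul_assoc, hQi]
    refine ⟨a, ?_⟩
    rw [← Matrix.mul_assoc, ← hcomm Q hQ, Matrix.mul_assoc, a]
  have b1 := hfix P hP rfl
  have b2 := hfix _ (hfS Real.pi) h2
  have c1 := hl _ b1.1 b2.1
  have c2 := hl _ b1.2 b2.2
  have hKK : K * (K * P) = 0 := by
    conv_lhs => rw [hK]
    rw [Matrix.sub_mul, Matrix.mul_assoc, Matrix.mul_assoc, c1, c2, Matrix.mul_smul, sub_self]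
  have hKh : Kᴴ = -K := by
    rw [hK, conjTranspose_sub, conjTranspose_mul, conjTranspose_mul,
      (pencil_isHermitian hA u).eq, (pencil_isHermitian hA w).eq, neg_sub]
  rw [← Matrix.conjTranspose_mul_self_eq_zero, conjTranspose_mul, hKh, Matrix.mul_assoc,
    Matrix.neg_mul, hKK]
  simp

end Commutator

section JointDiagonalization

variable {n m : ℕ}

theorem exists_joint_diagonalization {ι : Type*} (T : ι → Matrix (Fin n) (Fin n) ℂ)
    (hT : ∀ i, (T i).IsHermitian) (hc : ∀ i j, T i * T j = T j * T i) :
    ∃ U ∈ unitaryGroup (Fin n) ℂ, ∃ d : ι → Fin n → ℂ, ∀ i, T i * U = U * diagonal (d i) := by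
  classical
  let L : ι → EuclideanSpace ℂ (Fin n) →ₗ[ℂ] EuclideanSpace ℂ (Fin n) :=
    fun i => Matrix.toEuclideanLin (T i)
  have hL : ∀ i, (L i).IsSymmetric := fun i => Matrix.isSymmetric_toEuclideanLin_iff.2 (hT i)
  have hLc : Pairwise (Function.onFun Commute L) := by
    intro i j _
    apply LinearMap.ext
    intro x
    simp [L, Matrix.toLpLin_apply, Matrix.mulVec_mulVec, hc i j]
  have hinternal := LinearMap.IsSymmetric.directSum_isInternal_of_pairwise_commute hL hLc
  have horth := LinearMap.IsSymmetric.orthogonalFamily_iInf_eigenspaces hL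
  rw [← DirectSum.isInternal_ne_bot_iff] at hinternal
  have hfin : Fintype {χ : ι → ℂ // (⨅ j, Module.End.eigenspace (L j) (χ j)) ≠ ⊥} :=
    horth.independent.fintypeNeBotOfFiniteDimensional
  have horth' := horth.comp (Subtype.val_injective
    (p := fun χ : ι → ℂ => (⨅ j, Module.End.eigenspace (L j) (χ j)) ≠ ⊥))
  have hn : Module.finrank ℂ (EuclideanSpace ℂ (Fin n)) = n := by simp
  let b := hinternal.subordinateOrthonormalBasis hn horth'
  have hb := fun a => hinternal.subordinateOrthonormalBasis_subordinate hn a horth'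
  let χ := fun a => (hinternal.subordinateOrthonormalBasisIndex hn a horth').1
  refine ⟨(EuclideanSpace.basisFun (Fin n) ℂ).toBasis.toMatrix b,
    OrthonormalBasis.toMatrix_orthonormalBasis_mem_unitary _ _, fun i a => χ a i, fun i => ?_⟩
  ext s a
  have h1 := Module.End.mem_eigenspace_iff.1 ((Submodule.mem_iInf _).1 (hb a) i)
  have h2 := congrArg (fun v : EuclideanSpace ℂ (Fin n) => v s) h1
  simp only [L, Matrix.toLpLin_apply, PiLp.smul_apply, smul_eq_mul] at h2
  rw [Matrix.mul_diagonal, Matrix.mul_apply]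
  simp only [Module.Basis.toMatrix_apply, OrthonormalBasis.coe_toBasis_repr_apply,
    EuclideanSpace.basisFun_repr]
  rw [mul_comm]
  exact h2

theorem projection_diag_eq {P : Matrix (Fin n) (Fin n) ℂ} (hP : P.IsHermitian) (hi : P * P = P)
    (i : Fin n) : (P i i).re = ∑ l, ‖P l i‖ ^ 2 := by
  have h : Pᴴ * P = P := by rw [hP.eq, hi]
  conv_lhs => rw [← h, Matrix.mul_apply]
  rw [Complex.re_sum]
  refine Finset.sum_congr rfl fun l _ => ?_
  rw [conjTranspose_apply, ← Complex.normSq_eq_norm_sq, Complex.star_def,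
    ← Complex.normSq_eq_conj_mul_self, Complex.ofReal_re]

theorem projection_diag_nonneg {P : Matrix (Fin n) (Fin n) ℂ} (hP : P.IsHermitian)
    (hi : P * P = P) (i : Fin n) : 0 ≤ (P i i).re := by
  rw [projection_diag_eq hP hi]
  exact Finset.sum_nonneg fun l _ => sq_nonneg _

theorem projection_col_eq_zero {P : Matrix (Fin n) (Fin n) ℂ} (hP : P.IsHermitian)
    (hi : P * P = P) {i : Fin n} (h : (P i i).re ≤ 0) (l : Fin n) : P l i = 0 := by
  have h1 := (projection_diag_eq hP hi i).symm.trans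
    (le_antisymm h (projection_diag_nonneg hP hi i))
  have h2 := (Finset.sum_eq_zero_iff_of_nonneg fun l _ => sq_nonneg _).1 h1 l (Finset.mem_univ l)
  simpa using h2

theorem one_sub_isHermitian {P : Matrix (Fin n) (Fin n) ℂ} (hP : P.IsHermitian) :
    (1 - P).IsHermitian := by
  simp [IsHermitian, hP.eq]

theorem one_sub_idem {P : Matrix (Fin n) (Fin n) ℂ} (hi : P * P = P) :
    (1 - P) * (1 - P) = 1 - P := by
  rw [Matrix.mul_sub, Matrix.sub_mul _ _ P, hi]; simp

theorem projection_diag_le_one {P : Matrix (Fin n) (Fin n) ℂ} (hP : P.IsHermitian)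
    (hi : P * P = P) (i : Fin n) : (P i i).re ≤ 1 := by
  simpa using projection_diag_nonneg (one_sub_isHermitian hP) (one_sub_idem hi) i

theorem star_mem_unitaryGroup {U : Matrix (Fin n) (Fin n) ℂ} (hU : U ∈ unitaryGroup (Fin n) ℂ) :
    star U ∈ unitaryGroup (Fin n) ℂ :=
  Unitary.star_mem hU

/-- If the convex hull of the joint `k`-numerical range is polyhedral, then in a suitable
orthonormal basis some of the basis vectors are joint eigenvectors, and every real linear
combination of the matrices has a top spectral projection of rank `k` supported on them. -/
theorem exists_adapted_basis {A : Fin m → Matrix (Fin n) (Fin n) ℂ}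
    (hA : ∀ j, (A j).IsHermitian) {k : ℕ} (hk1 : 1 ≤ k) (hk2 : 2 * k ≤ n)
    (hpoly : IsPolyhedral (convexHull ℝ (jointKNumRangeR k A))) :
    ∃ U ∈ unitaryGroup (Fin n) ℂ, ∃ I : Finset (Fin n),
      (∀ j, ∀ i ∈ I, ∀ l, l ≠ i → (star U * A j * U) l i = 0) ∧
      ∀ u, ∃ P ∈ rankProj n k, (∃ c, IsTop (pencil (fun j => star U * A j * U) u) P c) ∧
        ∀ i ∉ I, ∀ l, P l i = 0 := by
  classical
  obtain ⟨S, hS, hcov⟩ := exists_exposed_projections hA hk1 hk2 hpoly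
  have hrank : ∀ P ∈ S, P ∈ rankProj n k := by
    intro P hP
    obtain ⟨v, hv⟩ := hS P hP
    have hv' : v ∈ {u | IsMax k (pencil A u) P} := interior_subset hv
    exact hv'.1
  have hcomm : ∀ P ∈ S, ∀ j, A j * P = P * A j := by
    intro P hP j
    simpa only [pencil_single] using commute_of_exposed hA hk1 hk2 (hS P hP) (Pi.single j 1)
  have hzero : ∀ P ∈ S, ∀ i j, A i * A j * P = A j * A i * P := by
    intro P hP i j
    have := commutator_mul_eq_zero hA hk1 hk2 hS hcov hP (Pi.single i 1) (Pi.single j 1)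
    simpa only [pencil_single, Matrix.sub_mul, sub_eq_zero] using this
  let Q := ∑ P ∈ S, P
  have hQh : Q.IsHermitian := by
    rw [IsHermitian, conjTranspose_sum]
    exact Finset.sum_congr rfl fun P hP => (isHermitian_of_mem_rankProj (hrank P hP)).eq
  have hQc : ∀ j, A j * Q = Q * A j := by
    intro j
    rw [Matrix.mul_sum, Matrix.sum_mul]
    exact Finset.sum_congr rfl fun P hP => hcomm P hP j
  have hQz : ∀ i j, A i * A j * Q = A j * A i * Q := by
    intro i j
    rw [Matrix.mul_sum, Matrix.mul_sum]
    exact Finset.sum_congr rfl fun P hP => hzero P hP i j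
  let T : Option (Fin m) → Matrix (Fin n) (Fin n) ℂ := fun o => o.elim Q fun j => A j * Q
  have hTh : ∀ o, (T o).IsHermitian := by
    rintro (_ | j)
    · exact hQh
    · change (A j * Q)ᴴ = A j * Q
      rw [conjTranspose_mul, hQh.eq, (hA j).eq, hQc]
  have hTc : ∀ o o', T o * T o' = T o' * T o := by
    have h1 : ∀ j, Q * (A j * Q) = A j * Q * Q := fun j => by
      rw [← Matrix.mul_assoc, ← hQc]
    rintro (_ | i) (_ | j)
    · rfl
    · exact h1 j
    · exact (h1 i).symm
    · change A i * Q * (A j * Q) = A j * Q * (A i * Q)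
      have h2 : ∀ i j, A i * Q * (A j * Q) = A i * A j * Q * Q := fun i j => by
        rw [Matrix.mul_assoc, h1, ← Matrix.mul_assoc, ← Matrix.mul_assoc]
      rw [h2, h2, hQz]
  obtain ⟨U, hU, d, hd⟩ := exists_joint_diagonalization T hTh hTc
  have hU' := star_mem_unitaryGroup hU
  refine ⟨U, hU, Finset.univ.filter fun i => d none i ≠ 0, ?_, ?_⟩
  · intro j i hi l hl
    have hQU : Q * U = U * diagonal (d none) := hd none
    have hAU : A j * Q * U = U * diagonal (d (some j)) := hd (some j)
    have e : star U * A j * U * diagonal (d none) = diagonal (d (some j)) := by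
      rw [Matrix.mul_assoc _ U, ← hQU, Matrix.mul_assoc, ← Matrix.mul_assoc (A j), hAU,
        star_mul_self_cancel hU]
    have e2 := congrFun (congrFun e l) i
    rw [Matrix.mul_diagonal, Matrix.diagonal_apply_ne _ hl] at e2
    exact (mul_eq_zero.1 e2).resolve_right (Finset.mem_filter.1 hi).2
  · intro u
    obtain ⟨P, hP, hm⟩ := hcov u
    obtain ⟨c, hc⟩ := hm.isTop hk1 hk2 (pencil_isHermitian hA u)
    refine ⟨star U * P * star (star U), conj_mem_rankProj hU' (hrank P hP), ⟨c, ?_⟩, ?_⟩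
    · have e : pencil (fun j => star U * A j * U) u = star U * pencil A u * star (star U) := by
        simp only [pencil_apply, Matrix.mul_sum, Matrix.sum_mul, star_star, Matrix.mul_smul,
          Matrix.smul_mul]
      rw [e]
      exact hc.conj hU'
    · intro i hi l
      have hi' : d none i = 0 := by simpa using hi
      have hR : ∀ P ∈ S, star U * P * star (star U) ∈ rankProj n k := fun P hP =>
        conj_mem_rankProj hU' (hrank P hP)
      have hsum : ∑ P ∈ S, ((star U * P * star (star U)) i i).re = 0 := by
        rw [← Complex.re_sum, ← Matrix.sum_apply, ← Matrix.sum_mul, ← Matrix.mul_sum, star_star,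
          Matrix.mul_assoc]
        have hQU : Q * U = U * diagonal (d none) := hd none
        change (((star U * (Q * U)) i i)).re = 0
        rw [hQU, star_mul_self_cancel hU, Matrix.diagonal_apply_eq, hi']
        rfl
      have h1 := (Finset.sum_eq_zero_iff_of_nonneg fun P hP => projection_diag_nonneg
        (isHermitian_of_mem_rankProj (hR P hP)) (idem_of_mem_rankProj (hR P hP)) i).1 hsum P hP
      exact projection_col_eq_zero (isHermitian_of_mem_rankProj (hR P hP))
        (idem_of_mem_rankProj (hR P hP)) h1.le l

end JointDiagonalization

section Hypersimplex

variable {n : ℕ}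

/-- The hypersimplex of vectors in `[0, 1] ^ n` supported on `I` with coordinate sum `r`. -/
def hypersimplex (I : Finset (Fin n)) (r : ℕ) : Set (Fin n → ℝ) :=
  {c | (∀ i, 0 ≤ c i ∧ c i ≤ 1) ∧ (∀ i ∉ I, c i = 0) ∧ ∑ i, c i = r}

/-- The coordinates at which a vector takes a value other than `0` and `1`. -/
noncomputable def fracSupport (c : Fin n → ℝ) : Finset (Fin n) :=
  Finset.univ.filter fun i => ¬ (c i = 0 ∨ c i = 1)

theorem mem_fracSupport {c : Fin n → ℝ} {i : Fin n} :
    i ∈ fracSupport c ↔ c i ≠ 0 ∧ c i ≠ 1 := by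
  simp [fracSupport]

/-- Move mass `s` from coordinate `j` to coordinate `i`. -/
noncomputable def transfer (c : Fin n → ℝ) (i j : Fin n) (s : ℝ) : Fin n → ℝ :=
  c + s • (Pi.single i 1 - Pi.single j 1)

theorem transfer_left {c : Fin n → ℝ} {i j : Fin n} (h : i ≠ j) (s : ℝ) :
    transfer c i j s i = c i + s := by
  simp [transfer, h]

theorem transfer_right {c : Fin n → ℝ} {i j : Fin n} (h : i ≠ j) (s : ℝ) :
    transfer c i j s j = c j - s := by
  simp [transfer, h.symm, sub_eq_add_neg]

theorem transfer_of_ne {c : Fin n → ℝ} {i j l : Fin n} (hi : l ≠ i) (hj : l ≠ j) (s : ℝ) :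
    transfer c i j s l = c l := by
  simp [transfer, hi, hj]

theorem exists_transfer {I : Finset (Fin n)} {r : ℕ} {c : Fin n → ℝ} (hc : c ∈ hypersimplex I r)
    {i j : Fin n} (hij : i ≠ j) (hi : i ∈ fracSupport c) (hj : j ∈ fracSupport c) :
    ∃ s > 0, transfer c i j s ∈ hypersimplex I r ∧
      (fracSupport (transfer c i j s)).card < (fracSupport c).card := by
  obtain ⟨h01, hI, hsum⟩ := hc
  have hi' := mem_fracSupport.1 hi
  have hj' := mem_fracSupport.1 hj
  have hi1 : c i < 1 := lt_of_le_of_ne (h01 i).2 hi'.2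
  have hj0 : 0 < c j := lt_of_le_of_ne (h01 j).1 hj'.1.symm
  have hs : 0 < min (1 - c i) (c j) := lt_min (sub_pos.2 hi1) hj0
  set s := min (1 - c i) (c j) with hsdef
  have hs1 : s ≤ 1 - c i := min_le_left _ _
  have hs2 : s ≤ c j := min_le_right _ _
  refine ⟨s, hs, ⟨?_, ?_, ?_⟩, Finset.card_lt_card ?_⟩
  · intro l
    by_cases h1 : l = i
    · subst h1
      rw [transfer_left hij]
      exact ⟨by linarith [(h01 l).1], by linarith⟩
    by_cases h2 : l = j
    · subst h2
      rw [transfer_right hij]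
      exact ⟨by linarith, by linarith [(h01 l).2]⟩
    rw [transfer_of_ne h1 h2]
    exact h01 l
  · intro l hl
    have h1 : l ≠ i := by rintro rfl; exact hi'.1 (hI l hl)
    have h2 : l ≠ j := by rintro rfl; exact hj'.1 (hI l hl)
    rw [transfer_of_ne h1 h2, hI l hl]
  · simp only [transfer, Pi.add_apply, Pi.smul_apply, Pi.sub_apply, smul_eq_mul,
      Finset.sum_add_distrib, ← Finset.mul_sum, Finset.sum_sub_distrib, Finset.sum_pi_single',
      Finset.mem_univ, if_true, hsum]
    simp
  · rw [Finset.ssubset_iff_of_subset]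
    · rcases min_choice (1 - c i) (c j) with h | h
      · refine ⟨i, hi, fun hmem => (mem_fracSupport.1 hmem).2 ?_⟩
        rw [transfer_left hij, hsdef, h]; ring
      · refine ⟨j, hj, fun hmem => (mem_fracSupport.1 hmem).1 ?_⟩
        rw [transfer_right hij, hsdef, h]; ring
    · intro l hl
      by_cases h1 : l = i
      · rwa [h1]
      by_cases h2 : l = j
      · rwa [h2]
      rw [mem_fracSupport, transfer_of_ne h1 h2] at hl
      exact mem_fracSupport.2 hl

theorem exists_ne_mem_fracSupport {I : Finset (Fin n)} {r : ℕ} {c : Fin n → ℝ}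
    (hc : c ∈ hypersimplex I r) {i : Fin n} (hi : i ∈ fracSupport c) :
    ∃ j, i ≠ j ∧ j ∈ fracSupport c := by
  by_contra! hcon
  obtain ⟨h01, -, hsum⟩ := hc
  have hi' := mem_fracSupport.1 hi
  have hinteger : ∀ l ∈ Finset.univ.erase i, c l = ((if c l = 1 then 1 else 0 : ℤ) : ℝ) := by
    intro l hl
    have hl' := hcon l (Finset.ne_of_mem_erase hl).symm
    rw [mem_fracSupport] at hl'
    by_cases h : c l = 1
    · simp [h]
    · have : c l = 0 := by by_contra h0; exact hl' ⟨h0, h⟩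
      simp [this]
  rw [← Finset.add_sum_erase _ _ (Finset.mem_univ i), Finset.sum_congr rfl hinteger,
    ← Int.cast_sum] at hsum
  set z : ℤ := ∑ l ∈ Finset.univ.erase i, (if c l = 1 then 1 else 0 : ℤ)
  have h0 : 0 < c i := lt_of_le_of_ne (h01 i).1 hi'.1.symm
  have h1 : c i < 1 := lt_of_le_of_ne (h01 i).2 hi'.2
  have e : c i = (((r : ℤ) - z : ℤ) : ℝ) := by push_cast; linarith
  rw [e] at h0 h1
  have h0' : 0 < (r : ℤ) - z := by exact_mod_cast h0
  have h1' : (r : ℤ) - z < 1 := by exact_mod_cast h1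
  omega

theorem hypersimplex_induction {I : Finset (Fin n)} {r : ℕ} {Q : (Fin n → ℝ) → Prop}
    (base : ∀ c ∈ hypersimplex I r, (∀ i, c i = 0 ∨ c i = 1) → Q c)
    (step : ∀ (c : Fin n → ℝ) (i j : Fin n) (s t : ℝ), i ≠ j → 0 < s → 0 < t →
      Q (transfer c i j s) → Q (transfer c j i t) → Q c) :
    ∀ c ∈ hypersimplex I r, Q c := by
  intro c
  induction h : (fracSupport c).card using Nat.strong_induction_on generalizing c with
  | _ N ih =>
    intro hc
    subst h
    rcases (fracSupport c).eq_empty_or_nonempty with he | ⟨i, hi⟩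
    · refine base c hc fun i => ?_
      have : i ∉ fracSupport c := by simp [he]
      rw [mem_fracSupport] at this
      tauto
    · obtain ⟨j, hij, hj⟩ := exists_ne_mem_fracSupport hc hi
      obtain ⟨s, hs, hs', hs''⟩ := exists_transfer hc hij hi hj
      obtain ⟨t, ht, ht', ht''⟩ := exists_transfer hc hij.symm hj hi
      exact step c i j s t hij hs ht (ih _ hs'' _ rfl hs') (ih _ ht'' _ rfl ht')

theorem convex_hypersimplex (I : Finset (Fin n)) (r : ℕ) : Convex ℝ (hypersimplex I r) := by
  rintro c ⟨h1, h2, h3⟩ d ⟨g1, g2, g3⟩ a b ha hb hab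
  refine ⟨fun i => ?_, fun i hi => ?_, ?_⟩
  · simp only [Pi.add_apply, Pi.smul_apply, smul_eq_mul]
    constructor
    · have := mul_nonneg ha (h1 i).1
      have := mul_nonneg hb (g1 i).1
      linarith
    · nlinarith [mul_le_mul_of_nonneg_left (h1 i).2 ha, mul_le_mul_of_nonneg_left (g1 i).2 hb]
  · simp [h2 i hi, g2 i hi]
  · simp only [Pi.add_apply, Pi.smul_apply, smul_eq_mul, Finset.sum_add_distrib, ← Finset.mul_sum,
      h3, g3]
    rw [← add_mul, hab, one_mul]

theorem isPolyhedral_hypersimplex (I : Finset (Fin n)) (r : ℕ) :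
    IsPolyhedral (hypersimplex I r) := by
  refine ⟨{c ∈ hypersimplex I r | ∀ i, c i = 0 ∨ c i = 1}, ?_, ?_⟩
  · have : (Set.univ.pi fun _ : Fin n => ({0, 1} : Set ℝ)).Finite :=
      Set.Finite.pi fun _ => Set.toFinite _
    refine this.subset fun c hc => ?_
    simpa [Set.mem_pi] using hc.2
  · refine Set.Subset.antisymm ?_ (convexHull_min (Set.sep_subset _ _) (convex_hypersimplex I r))
    refine hypersimplex_induction (fun c hc h => subset_convexHull ℝ _ ⟨hc, h⟩) ?_
    intro c i j s t _ hs ht h1 h2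
    have hst : 0 < s + t := add_pos hs ht
    have := convex_convexHull ℝ {c ∈ hypersimplex I r | ∀ i, c i = 0 ∨ c i = 1} h1 h2
      (div_nonneg ht.le hst.le) (div_nonneg hs.le hst.le) (by field_simp; ring)
    convert this using 1
    ext l
    simp only [transfer, Pi.add_apply, Pi.smul_apply, Pi.sub_apply, smul_eq_mul]
    field_simp
    ring

end Hypersimplex

section SchurHorn

variable {n : ℕ}

theorem exists_normSq_eq_and_mul_re_eq_zero (z : ℂ) {s : ℝ} (hs : 0 ≤ s) :
    ∃ β : ℂ, star β * β = s ∧ (β * z).re = 0 := by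
  rcases eq_or_ne z 0 with rfl | hz
  · refine ⟨(√s : ℂ), ?_, by simp⟩
    rw [Complex.star_def, Complex.conj_ofReal]
    exact_mod_cast Real.mul_self_sqrt hs
  · have hz' : (‖z‖ : ℂ) ≠ 0 := by simpa using hz
    refine ⟨(√s : ℂ) * Complex.I * star z / ‖z‖, ?_, ?_⟩
    · have h1 : (√s : ℂ) * √s = s := by exact_mod_cast Real.mul_self_sqrt hs
      have h2 : z * star z = (‖z‖ : ℂ) ^ 2 := Complex.mul_conj' z
      simp only [star_div₀, star_mul', Complex.star_def, Complex.conj_ofReal, Complex.conj_I,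
        Complex.conj_conj] at h2 ⊢
      field_simp
      linear_combination (-Complex.I ^ 2 * (z * (starRingEnd ℂ) z)) * h1 +
        (-Complex.I ^ 2 * s) * h2 - (s * (‖z‖ : ℂ) ^ 2) * Complex.I_sq
    · have h2 : star z * z = (‖z‖ : ℂ) ^ 2 := Complex.conj_mul' z
      have : (√s : ℂ) * Complex.I * star z / ‖z‖ * z = ((√s * ‖z‖ : ℝ) : ℂ) * Complex.I := by
        push_cast
        field_simp
        linear_combination (√s : ℂ) * h2
      rw [this]
      simp

/-- The unitary reflection acting on the span of the `i`-th and `j`-th basis vectors with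
diagonal entries `α`, `-α` and off-diagonal entries `β`, `star β`, and fixing the other ones. -/
noncomputable def planeReflection (i j : Fin n) (α : ℝ) (β : ℂ) : Matrix (Fin n) (Fin n) ℂ :=
  ((1 : Matrix (Fin n) (Fin n) ℂ).updateCol i (Pi.single i (α : ℂ) + Pi.single j β)).updateCol j
    (Pi.single i (star β) - Pi.single j (α : ℂ))

section Columns

variable {i j : Fin n} {α : ℝ} {β : ℂ}

theorem planeReflection_col_left (hij : i ≠ j) :
    (planeReflection i j α β).col i = Pi.single i (α : ℂ) + Pi.single j β := by
  ext l
  simp [planeReflection, hij]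

theorem planeReflection_col_right :
    (planeReflection i j α β).col j = Pi.single i (star β) - Pi.single j (α : ℂ) := by
  ext l
  simp [planeReflection]

theorem planeReflection_col_of_ne {l : Fin n} (hi : l ≠ i) (hj : l ≠ j) :
    (planeReflection i j α β).col l = Pi.single l 1 := by
  ext x
  simp [planeReflection, hi, hj, Matrix.one_apply, Pi.single_apply]

theorem planeReflection_mem_unitaryGroup (hij : i ≠ j) (h : (α : ℂ) * α + star β * β = 1) :
    planeReflection i j α β ∈ unitaryGroup (Fin n) ℂ := by
  have h' : β * (starRingEnd ℂ) β + (α : ℂ) * α = 1 := by rw [add_comm, mul_comm β]; exact h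
  rw [mem_unitaryGroup_iff']
  ext x y
  have e : (star (planeReflection i j α β) * planeReflection i j α β) x y =
      star ((planeReflection i j α β).col x) ⬝ᵥ (planeReflection i j α β).col y := rfl
  rw [e]
  have hji := hij.symm
  by_cases x1 : x = i
  · by_cases y1 : y = i
    · subst x1 y1
      simp [planeReflection_col_left hij, hij, hji]
      exact h
    by_cases y2 : y = j
    · simp [x1, y2, planeReflection_col_left hij, planeReflection_col_right, hij,
        hji]
      ring
    · simp [x1, planeReflection_col_left hij, planeReflection_col_of_ne y1 y2, Ne.symm y1,
        y1, y2]
  by_cases x2 : x = j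
  · by_cases y1 : y = i
    · simp [x2, y1, planeReflection_col_left hij, planeReflection_col_right, hij,
        hji]
      ring
    by_cases y2 : y = j
    · subst x2 y2
      simp [planeReflection_col_right, hij, hji]
      exact h'
    · simp [x2, planeReflection_col_right, planeReflection_col_of_ne y1 y2, Ne.symm y2,
        y1, y2]
  · by_cases y1 : y = i
    · simp [y1, planeReflection_col_left hij, planeReflection_col_of_ne x1 x2, x1, x2]
    by_cases y2 : y = j
    · simp [y2, planeReflection_col_right, planeReflection_col_of_ne x1 x2, x1, x2]
    · simp [planeReflection_col_of_ne x1 x2, planeReflection_col_of_ne y1 y2, Matrix.one_apply,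
        Pi.single_apply, eq_comm]

theorem conj_apply_self (U P : Matrix (Fin n) (Fin n) ℂ) (l : Fin n) :
    (star U * P * U) l l = star (U.col l) ⬝ᵥ P *ᵥ U.col l := by
  rw [Matrix.mul_assoc]
  rfl

end Columns

theorem exists_averaged_diagonal {r : ℕ} {P : Matrix (Fin n) (Fin n) ℂ} (hP : P ∈ rankProj n r)
    {i j : Fin n} (hij : i ≠ j) {τ : ℝ} (h0 : 0 ≤ τ) (h1 : τ ≤ 1) :
    ∃ P' ∈ rankProj n r, (P' i i).re = τ * (P i i).re + (1 - τ) * (P j j).re ∧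
      (P' j j).re = τ * (P j j).re + (1 - τ) * (P i i).re ∧
      ∀ l, l ≠ i → l ≠ j → P' l l = P l l := by
  obtain ⟨β, hβ, hz⟩ := exists_normSq_eq_and_mul_re_eq_zero (P i j) (sub_nonneg.2 h1)
  have hα : √τ * √τ = τ := Real.mul_self_sqrt h0
  have hU := planeReflection_mem_unitaryGroup (α := √τ) (β := β) hij (by
    rw [hβ]; rw [← Complex.ofReal_mul, hα]; push_cast; ring)
  have hji : P j i = star (P i j) := ((isHermitian_of_mem_rankProj hP).apply j i).symm
  have hβ' : β.re * β.re + β.im * β.im = 1 - τ := by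
    simpa using congrArg Complex.re hβ
  simp only [Complex.mul_re] at hz
  refine ⟨_, conj_mem_rankProj (star_mem_unitaryGroup hU) hP, ?_, ?_, ?_⟩
  · rw [star_star, conj_apply_self, planeReflection_col_left hij]
    simp [Matrix.mulVec_add, add_dotProduct, hji, Complex.mul_re]
    linear_combination hα * (P i i).re + hβ' * (P j j).re + 2 * √τ * hz
  · rw [star_star, conj_apply_self, planeReflection_col_right]
    simp [Matrix.mulVec_sub, sub_dotProduct, hji, Complex.mul_re]
    linear_combination hα * (P j j).re + hβ' * (P i i).re - 2 * √τ * hz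
  · intro l hi hj
    rw [star_star, conj_apply_self, planeReflection_col_of_ne hi hj]
    simp

theorem exists_rankProj_diag {I : Finset (Fin n)} {r : ℕ} :
    ∀ c ∈ hypersimplex I r, ∃ P ∈ rankProj n r, ∀ i, (P i i).re = c i := by
  refine hypersimplex_induction ?_ ?_
  · rintro c ⟨-, -, hsum⟩ h01
    refine ⟨_, diagonal_mem_rankProj (Finset.univ.filter fun i => c i = 1) ?_, fun i => ?_⟩
    · have : ∀ i, c i = if c i = 1 then 1 else 0 := fun i => by
        rcases h01 i with h | h <;> simp [h]
      rw [Finset.sum_congr rfl fun i _ => this i, Finset.sum_boole] at hsum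
      exact_mod_cast hsum
    · rcases h01 i with h | h <;> simp [h]
  · have main : ∀ (c : Fin n → ℝ) (i j : Fin n) (s : ℝ), i ≠ j → 0 < s → c j ≤ c i →
        (∃ P ∈ rankProj n r, ∀ l, (P l l).re = transfer c i j s l) →
        ∃ P ∈ rankProj n r, ∀ l, (P l l).re = c l := by
      rintro c i j s hij hs hle ⟨P, hP, hd⟩
      have hpos : 0 < c i - c j + 2 * s := by linarith
      obtain ⟨P', hP', e1, e2, e3⟩ := exists_averaged_diagonal hP hij
        (τ := (c i - c j + s) / (c i - c j + 2 * s)) (div_nonneg (by linarith) hpos.le)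
        ((div_le_one hpos).2 (by linarith))
      rw [hd i, hd j, transfer_left hij, transfer_right hij] at e1 e2
      have hτ := div_mul_cancel₀ (c i - c j + s) hpos.ne'
      set τ := (c i - c j + s) / (c i - c j + 2 * s)
      refine ⟨P', hP', fun l => ?_⟩
      by_cases h1 : l = i
      · rw [h1, e1]; linear_combination hτ
      by_cases h2 : l = j
      · rw [h2, e2]; linear_combination -hτ
      rw [e3 l h1 h2, hd l, transfer_of_ne h1 h2]
    intro c i j s t hij hs ht h1 h2
    rcases le_total (c j) (c i) with h | h
    · exact main c i j s hij hs h h1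
    · exact main c j i t hij.symm ht h h2

end SchurHorn

section LowerRank

variable {n m : ℕ}

/-- The combination of the diagonals of the matrices `B j` with weights `c`. -/
noncomputable def diagMap (B : Fin m → Matrix (Fin n) (Fin n) ℂ) :
    (Fin n → ℝ) →ₗ[ℝ] (Fin m → ℝ) :=
  Matrix.mulVecLin (Matrix.of fun j i => (B j i i).re)

theorem diagMap_apply (B : Fin m → Matrix (Fin n) (Fin n) ℂ) (c : Fin n → ℝ) (j : Fin m) :
    diagMap B c j = ∑ i, (B j i i).re * c i := rfl

theorem diagMap_dotProduct (B : Fin m → Matrix (Fin n) (Fin n) ℂ) (c : Fin n → ℝ)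
    (u : Fin m → ℝ) : diagMap B c ⬝ᵥ u = ∑ i, c i * (pencil B u i i).re := by
  simp only [dotProduct, diagMap_apply, pencil_apply, Matrix.sum_apply, Complex.re_sum,
    Finset.sum_mul, Finset.mul_sum]
  rw [Finset.sum_comm]
  refine Finset.sum_congr rfl fun i _ => Finset.sum_congr rfl fun j _ => ?_
  simp
  ring

theorem diag_im_eq_zero {P : Matrix (Fin n) (Fin n) ℂ} (hP : P.IsHermitian) (i : Fin n) :
    (P i i).im = 0 :=
  Complex.conj_eq_iff_im.1 (hP.apply i i)

theorem mul_apply_of_col {X Y : Matrix (Fin n) (Fin n) ℂ} {i : Fin n}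
    (h : ∀ l, l ≠ i → Y l i = 0) (x : Fin n) : (X * Y) x i = X x i * Y i i := by
  rw [Matrix.mul_apply, Finset.sum_eq_single i (fun l _ hl => by rw [h l hl, mul_zero])
    (fun hi => absurd (Finset.mem_univ i) hi)]

theorem traceVec_eq_diagMap {B : Fin m → Matrix (Fin n) (Fin n) ℂ} {I : Finset (Fin n)}
    (hI : ∀ j, ∀ i ∈ I, ∀ l, l ≠ i → B j l i = 0) {P : Matrix (Fin n) (Fin n) ℂ}
    (hP : P.IsHermitian) (hi : P * P = P) {c : Fin n → ℝ} (hc : ∀ i ∉ I, c i = 0)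
    (hPc : ∀ i, (P i i).re = c i) : traceVec B P = diagMap B c := by
  funext j
  rw [diagMap_apply, traceVec, Matrix.trace, Complex.re_sum]
  refine Finset.sum_congr rfl fun i _ => ?_
  by_cases h : i ∈ I
  · rw [diag_apply, mul_apply_of_col (hI j i h), Complex.mul_re, hPc, diag_im_eq_zero hP]
    ring
  · have h0 : (P i i).re ≤ 0 := (hPc i).trans_le (hc i h).le
    have hrow : ∀ l, P i l = 0 := fun l => by
      rw [← hP.apply, projection_col_eq_zero hP hi h0 l, star_zero]
    simp [Matrix.mul_apply, hrow, hc i h]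

theorem trace_mul_le_trace_mul_top {C R P : Matrix (Fin n) (Fin n) ℂ} {l : ℝ}
    (hT : IsTop C R l) (hP : P.IsHermitian) (hi : P * P = P) :
    (P * (C - (l : ℂ) • 1)).trace.re ≤ (P * ((C - (l : ℂ) • 1) * R)).trace.re := by
  have h1 := (Complex.le_def.1 (posSemidef_sandwich hT.bot hP).trace_nonneg).1
  rw [Matrix.trace_mul_comm, ← Matrix.mul_assoc, hi] at h1
  have e : P * (((l : ℂ) • 1 - C) * (1 - R)) =
      P * ((C - (l : ℂ) • 1) * R) - P * (C - (l : ℂ) • 1) := by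
    noncomm_ring
  rw [e, Matrix.trace_sub, Complex.sub_re, Complex.zero_re] at h1
  linarith

theorem exists_hypersimplex_trace_le {B : Fin m → Matrix (Fin n) (Fin n) ℂ}
    {I : Finset (Fin n)} (hI : ∀ j, ∀ i ∈ I, ∀ l, l ≠ i → B j l i = 0) {k r : ℕ} (hrk : r ≤ k)
    (hkn : k ≤ n) {u : Fin m → ℝ} {R P : Matrix (Fin n) (Fin n) ℂ} {l : ℝ}
    (hR : R ∈ rankProj n k) (hT : IsTop (pencil B u) R l) (hRI : ∀ i ∉ I, ∀ x, R x i = 0)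
    (hP : P ∈ rankProj n r) :
    ∃ c ∈ hypersimplex I r, traceVec B P ⬝ᵥ u ≤ diagMap B c ⬝ᵥ u := by
  have hPh := isHermitian_of_mem_rankProj hP
  have hPi := idem_of_mem_rankProj hP
  have hPt := trace_of_mem_rankProj (hrk.trans hkn) hP
  have hRt := trace_of_mem_rankProj hkn hR
  have hCI : ∀ i ∈ I, ∀ x, x ≠ i → pencil B u x i = 0 := by
    intro i hi x hx
    rw [pencil_apply, Matrix.sum_apply]
    exact Finset.sum_eq_zero fun j _ => by simp [hI j i hi x hx]
  set C := pencil B u with hC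
  set M := C - (l : ℂ) • (1 : Matrix (Fin n) (Fin n) ℂ) with hM
  have hMI : ∀ i ∈ I, ∀ x, x ≠ i → M x i = 0 := by
    intro i hi x hx
    simp [hM, hCI i hi x hx, Matrix.one_apply_ne hx]
  have hMR : M * R = R * M := by
    simp [hM, Matrix.sub_mul, Matrix.mul_sub, hT.comm]
  have hMh : M.IsHermitian := by
    have : M = M * R - ((l : ℂ) • 1 - C) * (1 - R) := by rw [hM]; noncomm_ring
    rw [this]
    exact hT.top.1.sub hT.bot.1
  let p : Fin n → ℝ := fun i => (P i i).re
  let q : Fin n → ℝ := fun i => (R i i).re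
  let μ : Fin n → ℝ := fun i => (M i i).re
  have hp0 : ∀ i, 0 ≤ p i := projection_diag_nonneg hPh hPi
  have hp1 : ∀ i, p i ≤ 1 := projection_diag_le_one hPh hPi
  have hq0 : ∀ i, 0 ≤ q i := projection_diag_nonneg hT.herm hT.idem
  have hq1 : ∀ i, q i ≤ 1 := projection_diag_le_one hT.herm hT.idem
  have hqI : ∀ i ∉ I, q i = 0 := fun i hi => by simp [q, hRI i hi i]
  have hsp : ∑ i, p i = r := by
    have := congrArg Complex.re hPt
    rwa [Matrix.trace, Complex.re_sum, Complex.natCast_re] at this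
  have hsq : ∑ i, q i = k := by
    have := congrArg Complex.re hRt
    rwa [Matrix.trace, Complex.re_sum, Complex.natCast_re] at this
  have hpos : ∀ i ∈ I, 0 < μ i → ∀ x, R x i = (1 : Matrix (Fin n) (Fin n) ℂ) x i := by
    intro i hi hμ x
    have h1 := (Complex.le_def.1 (hT.bot.diag_nonneg (i := i))).1
    have e : ((l : ℂ) • 1 - C) * (1 - R) = -((1 - R) * M) := by
      rw [Matrix.sub_mul 1 R M, ← hMR, hM]; noncomm_ring
    rw [e, Matrix.neg_apply, mul_apply_of_col (hMI i hi), Complex.neg_re, Complex.mul_re,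
      diag_im_eq_zero (one_sub_isHermitian hT.herm), zero_mul, sub_zero, Complex.zero_re] at h1
    have h2 := projection_col_eq_zero (one_sub_isHermitian hT.herm) (one_sub_idem hT.idem)
      (nonpos_of_mul_nonpos_left (neg_nonneg.1 h1) hμ) x
    exact (sub_eq_zero.1 h2).symm
  have hneg : ∀ i ∈ I, μ i < 0 → ∀ x, R x i = 0 := by
    intro i hi hμ x
    have h1 := (Complex.le_def.1 (hT.top.diag_nonneg (i := i))).1
    rw [← hM, hMR, mul_apply_of_col (hMI i hi)] at h1
    refine projection_col_eq_zero hT.herm hT.idem ?_ x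
    rw [Complex.mul_re, diag_im_eq_zero hT.herm, zero_mul, sub_zero, Complex.zero_re] at h1
    exact nonpos_of_mul_nonneg_left h1 hμ
  have hdiag : ∀ i, ((P * (M * R)) i i).re = p i * q i * μ i := by
    intro i
    by_cases hi : i ∈ I
    · rw [hMR, ← Matrix.mul_assoc, mul_apply_of_col (hMI i hi), Complex.mul_re,
        diag_im_eq_zero hMh, mul_zero, sub_zero]
      change ((P * R) i i).re * μ i = _
      rcases lt_trichotomy (μ i) 0 with h | h | h
      · simp [Matrix.mul_apply, hneg i hi h, q]
      · simp [h]
      · simp [Matrix.mul_apply, hpos i hi h, q, p, Matrix.one_apply]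
    · have : (P * (M * R)) i i = 0 := by
        rw [← Matrix.mul_assoc, Matrix.mul_apply]
        exact Finset.sum_eq_zero fun x _ => by rw [hRI i hi x, mul_zero]
      rw [this, hqI i hi]; simp
  have hqμ : ∀ i, 0 ≤ q i * (1 - p i) * μ i := by
    intro i
    by_cases hi : i ∈ I
    · rcases lt_trichotomy (μ i) 0 with h | h | h
      · simp [q, hneg i hi h i]
      · simp [h]
      · exact mul_nonneg (mul_nonneg (hq0 i) (sub_nonneg.2 (hp1 i))) h.le
    · simp [hqI i hi]
  have hpq : ∑ i, p i * q i ≤ r := by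
    rw [← hsp]
    exact Finset.sum_le_sum fun i _ => mul_le_of_le_one_right (hp0 i) (hq1 i)
  have hrk' : (r : ℝ) ≤ k := by exact_mod_cast hrk
  obtain ⟨s, hs0, hs1, hs⟩ : ∃ s : ℝ, 0 ≤ s ∧ s ≤ 1 ∧
      (1 - s) * ∑ i, p i * q i + s * ∑ i, q i = r := by
    rw [hsq]
    set α := ∑ i, p i * q i
    rcases eq_or_lt_of_le (hpq.trans hrk') with h | h
    · exact ⟨0, le_rfl, zero_le_one, by linarith⟩
    · have h' : 0 < k - α := sub_pos.2 h
      refine ⟨(r - α) / (k - α), div_nonneg (by linarith) h'.le,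
        (div_le_one h').2 (by linarith), ?_⟩
      linear_combination div_mul_cancel₀ (r - α) h'.ne'
  refine ⟨fun i => (1 - s) * (p i * q i) + s * q i, ⟨fun i => ⟨?_, ?_⟩, fun i hi => ?_, ?_⟩, ?_⟩
  · have := mul_nonneg (sub_nonneg.2 hs1) (mul_nonneg (hp0 i) (hq0 i))
    have := mul_nonneg hs0 (hq0 i)
    linarith
  · have h1 : p i * q i ≤ 1 := mul_le_one₀ (hp1 i) (hq0 i) (hq1 i)
    nlinarith [mul_le_mul_of_nonneg_left h1 (sub_nonneg.2 hs1),
      mul_le_mul_of_nonneg_left (hq1 i) hs0]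
  · simp [hqI i hi]
  · rw [Finset.sum_add_distrib, ← Finset.mul_sum, ← Finset.mul_sum, hs]
  · rw [← trace_mul_pencil, diagMap_dotProduct, ← hC]
    have h1 := trace_mul_le_trace_mul_top hT hPh hPi
    rw [← hM] at h1
    have h2 := congrArg Complex.re (trace_shift C P (l : ℂ))
    rw [← hM, hPt, Complex.sub_re, ← Complex.ofReal_natCast,
      ← Complex.ofReal_mul, Complex.ofReal_re] at h2
    have h3 : ∀ i, (C i i).re = μ i + l := fun i => by simp [μ, hM]
    have h4 : ∑ i, p i * q i * μ i ≤ ∑ i, ((1 - s) * (p i * q i) + s * q i) * μ i :=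
      Finset.sum_le_sum fun i _ => by linarith [mul_nonneg hs0 (hqμ i)]
    have h5 : ∑ i, ((1 - s) * (p i * q i) + s * q i) * l = r * l := by
      rw [← Finset.sum_mul, Finset.sum_add_distrib, ← Finset.mul_sum, ← Finset.mul_sum, hs]
    have h6 : (P * (M * R)).trace.re = ∑ i, p i * q i * μ i := by
      rw [Matrix.trace, Complex.re_sum]
      exact Finset.sum_congr rfl fun i _ => hdiag i
    simp only [h3, mul_add, Finset.sum_add_distrib, h5]
    linarith

theorem image_traceVec_eq {B : Fin m → Matrix (Fin n) (Fin n) ℂ} {I : Finset (Fin n)}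
    (hI : ∀ j, ∀ i ∈ I, ∀ l, l ≠ i → B j l i = 0) {k r : ℕ} (hrk : r ≤ k) (hkn : k ≤ n)
    (hR : ∀ u, ∃ P ∈ rankProj n k, (∃ c, IsTop (pencil B u) P c) ∧ ∀ i ∉ I, ∀ l, P l i = 0) :
    traceVec B '' rankProj n r = diagMap B '' hypersimplex I r := by
  refine Set.Subset.antisymm ?_ ?_
  · rintro _ ⟨P, hP, rfl⟩
    by_contra hmem
    obtain ⟨F, hF, hFe⟩ := isPolyhedral_hypersimplex I r
    have hclosed : IsClosed (diagMap B '' hypersimplex I r) := by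
      rw [hFe, LinearMap.image_convexHull]
      exact ((hF.image _).isCompact_convexHull (𝕜 := ℝ)).isClosed
    obtain ⟨f, a, h1, h2⟩ := geometric_hahn_banach_closed_point
      ((convex_hypersimplex I r).linear_image (diagMap B)) hclosed hmem
    have hf : ∀ v, f v = v ⬝ᵥ fun j => f (Pi.single j 1) := fun v => by
      conv_lhs => rw [pi_eq_sum_univ' v]
      simp [dotProduct, map_sum]
    obtain ⟨R, hR, ⟨l, hT⟩, hRI⟩ := hR fun j => f (Pi.single j 1)
    obtain ⟨c, hc, hle⟩ := exists_hypersimplex_trace_le hI hrk hkn hR hT hRI hP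
    rw [← hf, ← hf] at hle
    exact absurd (h1 _ (Set.mem_image_of_mem _ hc)) (not_lt.2 (h2.le.trans hle))
  · rintro _ ⟨c, hc, rfl⟩
    obtain ⟨P, hP, hPc⟩ := exists_rankProj_diag c hc
    exact ⟨P, hP, traceVec_eq_diagMap hI (isHermitian_of_mem_rankProj hP)
      (idem_of_mem_rankProj hP) hc.2.1 hPc⟩

theorem image_traceVec_conj (A : Fin m → Matrix (Fin n) (Fin n) ℂ)
    {U : Matrix (Fin n) (Fin n) ℂ} (hU : U ∈ unitaryGroup (Fin n) ℂ) (r : ℕ) :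
    traceVec (fun j => star U * A j * U) '' rankProj n r = traceVec A '' rankProj n r := by
  have e : ∀ P, traceVec (fun j => star U * A j * U) P = traceVec A (U * P * star U) := by
    intro P
    funext j
    rw [traceVec, traceVec, Matrix.mul_assoc U, Matrix.mul_assoc U, Matrix.trace_mul_comm U]
    simp only [Matrix.mul_assoc]
  ext v
  constructor
  · rintro ⟨P, hP, rfl⟩
    exact ⟨_, conj_mem_rankProj hU hP, (e P).symm⟩
  · rintro ⟨P, hP, rfl⟩
    refine ⟨_, conj_mem_rankProj (star_mem_unitaryGroup hU) hP, ?_⟩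
    rw [e, star_star]
    simp only [Matrix.mul_assoc, mem_unitaryGroup_iff.1 hU, Matrix.mul_one]
    rw [mul_star_self_cancel hU]

end LowerRank

end JointKNumRange

theorem stmt_18 {n m : ℕ} (hm : 0 < m)
    (A : Fin m → Matrix (Fin n) (Fin n) ℂ) (hA : ∀ j, (A j).IsHermitian)
    (k : ℕ) (hk1 : 1 ≤ k) (hk2 : 2 * k ≤ n)
    (hpoly : IsPolyhedral (convexHull ℝ (jointKNumRangeR k A))) :
    ∀ r : ℕ, 1 ≤ r → r ≤ k → IsPolyhedral (jointKNumRangeR r A) := by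
  intro r _ hrk
  obtain ⟨U, hU, I, hI, hR⟩ := JointKNumRange.exists_adapted_basis hA hk1 hk2 hpoly
  obtain ⟨F, hF, hFe⟩ := JointKNumRange.isPolyhedral_hypersimplex I r
  rw [JointKNumRange.jointKNumRangeR_eq_image hA, ← JointKNumRange.image_traceVec_conj A hU,
    JointKNumRange.image_traceVec_eq hI hrk (by omega) hR, hFe, LinearMap.image_convexHull]
  exact ⟨_, hF.image _, rfl⟩
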